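/- Let σ > 0 and let γ_{σ²} be the centered Gaussian measure on ℝ with variance σ². Define D_u*(R) := inf { ∫_ℝ min_{ω∈C} (y − ω)² dγ_{σ²}(y) : C a uniform codebook with |C| ≤ 2^R } for integer R ≥ 1. Then lim_{R→∞} (2^{2R}/R) · D_u*(R) = (4/3) · σ² · ln 2. -/

import Mathlib

open MeasureTheory ProbabilityTheory Real Filter

/-- A uniform codebook: a finite set of the form `{a + iΔ : i = 0, …, M-1}`
for some `a ∈ ℝ`, `Δ > 0`, `M ∈ ℕ`. -/
def IsUniformCodebook (C : Finset ℝ) : Prop :=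
  ∃ (a Δ : ℝ) (M : ℕ), 0 < Δ ∧
    C = Finset.image (fun i : ℕ => a + i * Δ) (Finset.range M)

/-- The optimal uniform scalar distortion-rate function at rate `R` bits of the centered
Gaussian source on `ℝ` with variance `σ²`:
`D_u*(R) = inf { ∫ min_{ω ∈ C} (y - ω)² dγ_{σ²}(y) : C uniform codebook, |C| ≤ 2^R }`. -/
noncomputable def DuGauss (σ : ℝ) (R : ℕ) : ℝ :=
  sInf {d : ℝ | ∃ (C : Finset ℝ) (hC : C.Nonempty), IsUniformCodebook C ∧ C.card ≤ 2 ^ R ∧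
    d = ∫ y, C.inf' hC (fun c => (y - c) ^ 2) ∂(gaussianReal 0 (Real.toNNReal (σ ^ 2)))}

open scoped NNReal

lemma integrable_gaussianReal_iff {μ : ℝ} {v : ℝ≥0} (hv : v ≠ 0) {f : ℝ → ℝ} :
    Integrable f (gaussianReal μ v) ↔ Integrable (fun x => gaussianPDFReal μ v x * f x) := by
  rw [gaussianReal_of_var_ne_zero _ hv, integrable_withDensity_iff_integrable_smul'
    (measurable_gaussianPDF _ _) (ae_of_all _ fun _ => gaussianPDF_lt_top)]
  simp [toReal_gaussianPDF]

lemma integral_gaussianReal_eq {μ : ℝ} {v : ℝ≥0} (hv : v ≠ 0) (f : ℝ → ℝ) :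
    ∫ x, f x ∂(gaussianReal μ v) = ∫ x, gaussianPDFReal μ v x * f x := by
  simpa using integral_gaussianReal_eq_integral_smul (f := f) hv

lemma integrable_sub_sq_gaussianReal (μ c : ℝ) (v : ℝ≥0) :
    Integrable (fun y => (y - c) ^ 2) (gaussianReal μ v) := by
  have h := (memLp_id_gaussianReal (μ := μ) (v := v) 2).sub (memLp_const c)
  exact h.integrable_sq

lemma integral_sub_mean_sq_gaussianReal (μ : ℝ) (v : ℝ≥0) :
    ∫ y, (y - μ) ^ 2 ∂(gaussianReal μ v) = v := by
  have h := variance_fun_id_gaussianReal (μ := μ) (v := v)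
  rw [variance_eq_integral measurable_id'.aemeasurable] at h
  simpa only [integral_id_gaussianReal] using h

/-- The squared distance to the nearest integer. -/
noncomputable def roundSq (t : ℝ) : ℝ := (t - round t) ^ 2

lemma measurable_roundSq : Measurable roundSq := by
  unfold roundSq
  have : Measurable (fun t : ℝ => ((round t : ℤ) : ℝ)) := by
    simp only [round_eq]
    fun_prop
  fun_prop

lemma roundSq_nonneg (t : ℝ) : 0 ≤ roundSq t := sq_nonneg _

lemma roundSq_le_one (t : ℝ) : roundSq t ≤ 1 := by
  have h := abs_sub_round t
  unfold roundSq
  rw [sq_le_one_iff_abs_le_one]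
  linarith

lemma roundSq_le (t : ℝ) (n : ℤ) : roundSq t ≤ (t - n) ^ 2 :=
  sq_le_sq.2 (round_le t n)

lemma periodic_roundSq : Function.Periodic roundSq 1 := by
  intro t
  simp [roundSq, round_add_one]

lemma integral_roundSq_period (t : ℝ) : ∫ x in t..t + 1, roundSq x = 1 / 12 := by
  rw [periodic_roundSq.intervalIntegral_add_eq t (-(1 / 2))]
  have : ∫ x in (-(1 / 2) : ℝ)..-(1 / 2) + 1, roundSq x
      = ∫ x in (-(1 / 2) : ℝ)..-(1 / 2) + 1, x ^ 2 := by
    rw [intervalIntegral.integral_of_le (by norm_num), intervalIntegral.integral_of_le (by norm_num),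
      ← integral_Ico_eq_integral_Ioc, ← integral_Ico_eq_integral_Ioc]
    refine setIntegral_congr_fun measurableSet_Ico fun x hx => ?_
    have hx' : round x = 0 := round_eq_zero_iff.2 ⟨hx.1, by linarith [hx.2]⟩
    simp [roundSq, hx']
  rw [this, integral_pow]
  norm_num

lemma integral_roundSq_shift {Δ : ℝ} (hΔ : 0 < Δ) (y : ℝ) :
    ∫ s in (0 : ℝ)..Δ, roundSq ((y - s) / Δ) = Δ / 12 := by
  have h : ∀ s, roundSq ((y - s) / Δ) = roundSq (y / Δ - s / Δ) := fun s => by rw [sub_div]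
  simp only [h]
  rw [intervalIntegral.integral_comp_sub_div _ hΔ.ne']
  have h2 := integral_roundSq_period (y / Δ - 1)
  rw [sub_add_cancel] at h2
  rw [div_self hΔ.ne', zero_div, sub_zero, h2, smul_eq_mul]
  ring

/-- The mean of `roundSq ((y - a) / Δ)` for a centered Gaussian variable `y`. -/
noncomputable def gaussRoundSq (v : ℝ≥0) (Δ a : ℝ) : ℝ :=
  ∫ y, roundSq ((y - a) / Δ) ∂(gaussianReal 0 v)

lemma integrable_roundSq_comp {μ : Measure ℝ} [IsFiniteMeasure μ] (Δ a : ℝ) :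
    Integrable (fun y => roundSq ((y - a) / Δ)) μ := by
  refine Integrable.of_bound (C := 1) ?_ (ae_of_all _ fun y => ?_)
  · exact (measurable_roundSq.comp (by fun_prop)).aestronglyMeasurable
  · rw [Real.norm_of_nonneg (roundSq_nonneg _)]; exact roundSq_le_one _

lemma integrable_uncurry_roundSq (v : ℝ≥0) (Δ a : ℝ) :
    Integrable (Function.uncurry fun (y s : ℝ) => roundSq ((y - (a + s)) / Δ))
      ((gaussianReal 0 v).prod (volume.restrict (Set.Ioc 0 Δ))) := by
  refine Integrable.of_bound (C := 1) ?_ (ae_of_all _ fun y => ?_)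
  · refine Measurable.aestronglyMeasurable ?_
    exact measurable_roundSq.comp (by fun_prop)
  · simp only [Function.uncurry]
    rw [Real.norm_of_nonneg (roundSq_nonneg _)]; exact roundSq_le_one _

lemma intervalIntegrable_gaussRoundSq (v : ℝ≥0) {Δ : ℝ} (hΔ : 0 < Δ) (a : ℝ) :
    IntervalIntegrable (fun s => gaussRoundSq v Δ (a + s)) volume 0 Δ := by
  rw [intervalIntegrable_iff_integrableOn_Ioc_of_le hΔ.le]
  exact (integrable_uncurry_roundSq v Δ a).integral_prod_right

lemma integral_gaussRoundSq (v : ℝ≥0) {Δ : ℝ} (hΔ : 0 < Δ) (a : ℝ) :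
    ∫ s in (0 : ℝ)..Δ, gaussRoundSq v Δ (a + s) = Δ / 12 := by
  rw [intervalIntegral.integral_of_le hΔ.le]
  unfold gaussRoundSq
  rw [← integral_integral_swap (integrable_uncurry_roundSq v Δ a)]
  have : ∀ y : ℝ, ∫ s in Set.Ioc 0 Δ, roundSq ((y - (a + s)) / Δ) = Δ / 12 := fun y => by
    rw [← intervalIntegral.integral_of_le hΔ.le, ← integral_roundSq_shift hΔ (y - a)]
    simp only [sub_sub]
  simp [this]

lemma gaussianPDFReal_add_ge (v : ℝ≥0) (z s : ℝ) :
    gaussianPDFReal 0 v z * (1 - (2 * z * s + s ^ 2) / (2 * v)) ≤ gaussianPDFReal 0 v (z + s) := by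
  have h : gaussianPDFReal 0 v (z + s)
      = gaussianPDFReal 0 v z * rexp (-((2 * z * s + s ^ 2) / (2 * v))) := by
    unfold gaussianPDFReal
    rw [mul_assoc _ (rexp _), ← Real.exp_add]
    congr 2
    ring
  rw [h]
  refine mul_le_mul_of_nonneg_left ?_ (gaussianPDFReal_nonneg _ _ _)
  have := Real.add_one_le_exp (-((2 * z * s + s ^ 2) / (2 * (v : ℝ))))
  linarith

lemma gaussRoundSq_add_ge {v : ℝ≥0} (hv : v ≠ 0) (Δ a s : ℝ) :
    gaussRoundSq v Δ a - (1 + 1 / v) * (|s| + s ^ 2) ≤ gaussRoundSq v Δ (a + s) := by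
  have hv0 : (0 : ℝ) < v := by positivity
  have h1 : gaussRoundSq v Δ (a + s)
      = ∫ z, gaussianPDFReal 0 v (z + s) * roundSq ((z - a) / Δ) := by
    unfold gaussRoundSq
    rw [integral_gaussianReal_eq hv, ← integral_add_right_eq_self _ s]
    congr with z
    congr 3
    ring
  have hint1 : Integrable (fun z => gaussianPDFReal 0 v (z + s) * roundSq ((z - a) / Δ)) := by
    have := (integrable_gaussianReal_iff (μ := 0) hv).1
      (integrable_roundSq_comp (μ := gaussianReal 0 v) Δ (a + s))
    refine (this.comp_add_right s).congr (ae_of_all _ fun z => ?_)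
    simp only
    congr 3
    ring
  have hi2 : Integrable (fun z : ℝ => |s| / v * (1 + (z - 0) ^ 2) + s ^ 2 / (2 * v))
      (gaussianReal 0 v) :=
    (((integrable_const _).add (integrable_sub_sq_gaussianReal 0 0 v)).const_mul _).add
      (integrable_const _)
  have hint2 := (integrable_roundSq_comp (μ := gaussianReal 0 v) Δ a).sub hi2
  have h2 : ∫ z, (roundSq ((z - a) / Δ) - (|s| / v * (1 + (z - 0) ^ 2) + s ^ 2 / (2 * v)))
      ∂(gaussianReal 0 v) ≤ gaussRoundSq v Δ (a + s) := by
    rw [h1, integral_gaussianReal_eq hv]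
    refine integral_mono ((integrable_gaussianReal_iff hv).1 hint2) hint1 fun z => ?_
    have hr0 := roundSq_nonneg ((z - a) / Δ)
    have hr1 := roundSq_le_one ((z - a) / Δ)
    have hp := gaussianPDFReal_nonneg 0 v z
    have hp2 := gaussianPDFReal_add_ge v z s
    refine le_trans ?_ (mul_le_mul_of_nonneg_right hp2 hr0)
    rw [mul_assoc]
    refine mul_le_mul_of_nonneg_left ?_ hp
    have key : (2 * z * s + s ^ 2) / (2 * v) ≤ |s| / v * (1 + (z - 0) ^ 2) + s ^ 2 / (2 * v) := by
      have e : |s| / v * (1 + (z - 0) ^ 2) + s ^ 2 / (2 * v)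
          = (2 * (|s| * (1 + z ^ 2)) + s ^ 2) / (2 * v) := by field_simp; ring
      rw [e]
      gcongr ?_ / _
      have h3 : z * s ≤ |z| * |s| := by rw [← abs_mul]; exact le_abs_self _
      have h4 : |z| ≤ 1 + z ^ 2 := by nlinarith [sq_abs z, sq_nonneg (|z| - 1)]
      nlinarith [abs_nonneg s, mul_le_mul_of_nonneg_right h4 (abs_nonneg s)]
    have pos : 0 ≤ |s| / v * (1 + (z - 0) ^ 2) + s ^ 2 / (2 * v) := by positivity
    nlinarith [mul_le_mul_of_nonneg_right key hr0, mul_le_mul_of_nonneg_left hr1 pos]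
  rw [integral_sub (integrable_roundSq_comp Δ a) hi2, integral_add _ (integrable_const _),
    integral_const_mul, integral_add (integrable_const _) (integrable_sub_sq_gaussianReal 0 0 v),
    integral_sub_mean_sq_gaussianReal] at h2
  · simp only [integral_const, probReal_univ, smul_eq_mul, one_mul] at h2
    have e : |s| / v * (1 + v) + s ^ 2 / (2 * v) ≤ (1 + 1 / v) * (|s| + s ^ 2) := by
      have : (1 + 1 / v) * (|s| + s ^ 2) - (|s| / v * (1 + v) + s ^ 2 / (2 * v))
        = s ^ 2 * (1 + 1 / (2 * v)) := by field_simp; ring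
      have : 0 ≤ s ^ 2 * (1 + 1 / (2 * (v : ℝ))) := by positivity
      linarith
    change gaussRoundSq v Δ a - _ ≤ _ at h2
    linarith
  · exact ((integrable_const _).add (integrable_sub_sq_gaussianReal 0 0 v)).const_mul _

lemma gaussRoundSq_sub_abs_le {v : ℝ≥0} (hv : v ≠ 0) {Δ : ℝ} (hΔ : 0 < Δ) (a : ℝ) :
    |gaussRoundSq v Δ a - 1 / 12| ≤ (1 + 1 / v) * (Δ + Δ ^ 2) := by
  set e := (1 + 1 / (v : ℝ)) * (Δ + Δ ^ 2) with he
  have hb : ∀ s ∈ Set.Icc 0 Δ, (1 + 1 / (v : ℝ)) * (|s| + s ^ 2) ≤ e := fun s hs => by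
    rw [abs_of_nonneg hs.1]
    have h0 := hs.1
    have h1 := hs.2
    rw [he]
    gcongr
  have h1 : ∫ s in (0 : ℝ)..Δ, (gaussRoundSq v Δ a - e) ≤ Δ / 12 := by
    rw [← integral_gaussRoundSq v hΔ a]
    refine intervalIntegral.integral_mono_on hΔ.le (by simp) (intervalIntegrable_gaussRoundSq v hΔ a)
      fun s hs => ?_
    have := gaussRoundSq_add_ge hv Δ a s
    linarith [hb s hs]
  have h2 : Δ / 12 ≤ ∫ s in (0 : ℝ)..Δ, (gaussRoundSq v Δ a + e) := by
    rw [← integral_gaussRoundSq v hΔ a]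
    refine intervalIntegral.integral_mono_on hΔ.le (intervalIntegrable_gaussRoundSq v hΔ a) (by simp)
      fun s hs => ?_
    have := gaussRoundSq_add_ge hv Δ (a + s) (-s)
    rw [abs_neg, neg_sq, add_neg_cancel_right] at this
    linarith [hb s hs]
  simp only [intervalIntegral.integral_const, smul_eq_mul, sub_zero] at h1 h2
  rw [abs_le]
  constructor <;> nlinarith

lemma integrable_inf'_sub_sq (C : Finset ℝ) (hC : C.Nonempty) (v : ℝ≥0) :
    Integrable (fun y => C.inf' hC fun c => (y - c) ^ 2) (gaussianReal 0 v) := by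
  obtain ⟨c₀, hc₀⟩ := id hC
  refine (integrable_sub_sq_gaussianReal 0 c₀ v).mono' ?_ (ae_of_all _ fun y => ?_)
  · refine Continuous.aestronglyMeasurable ?_
    exact Continuous.finset_inf'_apply hC fun c _ => by fun_prop
  · rw [Real.norm_of_nonneg (Finset.le_inf' _ _ fun c _ => sq_nonneg _)]
    exact Finset.inf'_le (fun c => (y - c) ^ 2) hc₀

lemma mul_gaussRoundSq_le_integral_inf' (C : Finset ℝ) (hC : C.Nonempty) (v : ℝ≥0) {δ a : ℝ}
    (hδ : 0 < δ) (h : ∀ c ∈ C, ∃ n : ℤ, c = a + n * δ) :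
    δ ^ 2 * gaussRoundSq v δ a ≤ ∫ y, C.inf' hC (fun c => (y - c) ^ 2) ∂(gaussianReal 0 v) := by
  unfold gaussRoundSq
  rw [← integral_const_mul]
  refine integral_mono ((integrable_roundSq_comp _ _).const_mul _)
    (integrable_inf'_sub_sq C hC v) fun y => Finset.le_inf' _ _ fun c hc => ?_
  obtain ⟨n, rfl⟩ := h c hc
  have := mul_le_mul_of_nonneg_left (roundSq_le ((y - a) / δ) n) (sq_nonneg δ)
  refine this.trans_eq ?_
  field_simp
  ring

lemma gaussianPDFReal_le_integral_inf' (C : Finset ℝ) (hC : C.Nonempty) {v : ℝ≥0} (hv : v ≠ 0)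
    {x L : ℝ} (hx : |x| ≤ L + 1) (hx' : |x + 1| ≤ L + 1)
    (h : ∀ c ∈ C, ∀ y ∈ Set.Icc x (x + 1), 1 ≤ (y - c) ^ 2) :
    gaussianPDFReal 0 v (L + 1) ≤ ∫ y, C.inf' hC (fun c => (y - c) ^ 2) ∂(gaussianReal 0 v) := by
  rw [integral_gaussianReal_eq hv]
  have hint := (integrable_gaussianReal_iff hv).1 (integrable_inf'_sub_sq C hC v)
  have h0 : ∀ y : ℝ, 0 ≤ C.inf' hC fun c => (y - c) ^ 2 :=
    fun y => Finset.le_inf' _ _ fun c _ => sq_nonneg _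
  calc gaussianPDFReal 0 v (L + 1)
      = ∫ y in Set.Icc x (x + 1), gaussianPDFReal 0 v (L + 1) := by simp
    _ ≤ ∫ y in Set.Icc x (x + 1), gaussianPDFReal 0 v y * C.inf' hC (fun c => (y - c) ^ 2) := by
        refine setIntegral_mono_on (by simp) hint.integrableOn measurableSet_Icc fun y hy => ?_
        have hinf : 1 ≤ C.inf' hC fun c => (y - c) ^ 2 := Finset.le_inf' _ _ fun c hc => h c hc y hy
        refine le_trans ?_ (le_mul_of_one_le_right (gaussianPDFReal_nonneg 0 v y) hinf)
        have hy' : |y| ≤ |L + 1| :=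
          (abs_le.2 ⟨by linarith [hy.1, (abs_le.1 hx).1], by linarith [hy.2, (abs_le.1 hx').2]⟩ :
            |y| ≤ L + 1).trans (le_abs_self _)
        have := sq_le_sq.2 hy'
        unfold gaussianPDFReal
        simp only [sub_zero]
        gcongr
    _ ≤ _ := setIntegral_le_integral hint (ae_of_all _ fun y =>
        mul_nonneg (gaussianPDFReal_nonneg 0 v y) (h0 y))

/-- A uniform codebook with at most `N` points either is at least as coarse as a lattice of step
about `2 * L / N`, or misses one of the two tails outside `[-L, L]`. -/
lemma min_le_integral_inf' (C : Finset ℝ) (hC : C.Nonempty) (hu : IsUniformCodebook C) {N : ℕ}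
    (hN : C.card ≤ N) {v : ℝ≥0} (hv : v ≠ 0) {L δ : ℝ} (hL : 0 < L) (hδ : δ = 2 * L / N)
    (hB : 0 ≤ 1 / 12 - (1 + 1 / v) * (2 * δ + (2 * δ) ^ 2)) :
    min (δ ^ 2 * (1 / 12 - (1 + 1 / v) * (2 * δ + (2 * δ) ^ 2))) (gaussianPDFReal 0 v (L + 2)) ≤
      ∫ y, C.inf' hC (fun c => (y - c) ^ 2) ∂(gaussianReal 0 v) := by
  obtain ⟨a, Δ, M, hΔ, rfl⟩ := hu
  have hM : M ≤ N := by
    rwa [Finset.card_image_of_injective, Finset.card_range] at hN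
    intro i j hij
    have : (i : ℝ) * Δ = j * Δ := by simpa using hij
    exact_mod_cast mul_right_cancel₀ hΔ.ne' this
  have hM0 : 0 < M := by
    rcases Nat.eq_zero_or_pos M with rfl | h
    · simp at hC
    · exact h
  have hN0 : (0 : ℝ) < N := by exact_mod_cast hM0.trans_le hM
  have hδ0 : 0 < δ := by rw [hδ]; positivity
  rcases le_or_gt δ Δ with hc | hc
  · refine (min_le_left _ _).trans ?_
    set k := ⌊Δ / δ⌋₊ with hk
    have hk1 : 1 ≤ k := Nat.le_floor (by rw [Nat.cast_one, one_le_div hδ0]; exact hc)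
    have hk1' : (1 : ℝ) ≤ k := by exact_mod_cast hk1
    have hkle : (k : ℝ) ≤ Δ / δ := Nat.floor_le (by positivity)
    have hlt : Δ / δ < k + 1 := Nat.lt_floor_add_one _
    rw [le_div_iff₀ hδ0] at hkle
    rw [div_lt_iff₀ hδ0] at hlt
    have hk0 : (0 : ℝ) < k := by linarith
    have h1 : δ ≤ Δ / k := by rw [le_div_iff₀ hk0]; linarith
    have h2 : Δ / k ≤ 2 * δ := by rw [div_le_iff₀ hk0]; nlinarith
    refine le_trans ?_ (mul_gaussRoundSq_le_integral_inf' (a := a) _ hC v (hδ0.trans_le h1) ?_)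
    · have h3 := (abs_le.1 (gaussRoundSq_sub_abs_le hv (hδ0.trans_le h1) a)).1
      have h4 : (1 + 1 / (v : ℝ)) * (Δ / k + (Δ / k) ^ 2)
          ≤ (1 + 1 / v) * (2 * δ + (2 * δ) ^ 2) := by
        have : 0 ≤ Δ / k := hδ0.le.trans h1
        gcongr
      refine mul_le_mul (by gcongr) (by linarith) hB (sq_nonneg _)
    · intro c hc
      obtain ⟨i, -, rfl⟩ := Finset.mem_image.1 hc
      refine ⟨(i * k : ℕ), ?_⟩
      push_cast
      field_simp
  · refine (min_le_right _ _).trans ?_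
    have e : L + 2 = (L + 1) + 1 := by ring
    rw [e]
    rcases le_or_gt (-L) a with ha | ha
    · refine gaussianPDFReal_le_integral_inf' _ hC hv (x := -(L + 2)) ?_ ?_ ?_
      · rw [abs_le]; constructor <;> linarith
      · rw [abs_le]; constructor <;> linarith
      · intro c hc y hy
        obtain ⟨i, -, rfl⟩ := Finset.mem_image.1 hc
        have : 0 ≤ (i : ℝ) * Δ := by positivity
        have := hy.2
        nlinarith
    · refine gaussianPDFReal_le_integral_inf' _ hC hv (x := L + 1) ?_ ?_ ?_
      · rw [abs_le]; constructor <;> linarith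
      · rw [abs_le]; constructor <;> linarith
      · intro c hc' y hy
        obtain ⟨i, hi, rfl⟩ := Finset.mem_image.1 hc'
        have hi' : (i : ℝ) ≤ N := by exact_mod_cast (Finset.mem_range.1 hi).le.trans hM
        have h1 : (i : ℝ) * Δ ≤ N * δ := by gcongr
        have h2 : N * δ = 2 * L := by rw [hδ]; field_simp
        have := hy.1
        nlinarith

lemma gaussianPDFReal_le_exp_mul {v : ℝ≥0} {L y : ℝ} (h : 0 ≤ L * (y - L)) :
    gaussianPDFReal 0 v y ≤ rexp (-L ^ 2 / (2 * v)) * gaussianPDFReal L v y := by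
  unfold gaussianPDFReal
  rw [mul_left_comm, ← Real.exp_add, ← add_div]
  gcongr
  nlinarith

lemma exists_integral_inf'_le {N : ℕ} (hN : 2 ≤ N) {v : ℝ≥0} (hv : v ≠ 0) {L δ : ℝ} (hL : 0 < L)
    (hδ : δ = 2 * L / (N - 1)) :
    ∃ (C : Finset ℝ) (hC : C.Nonempty), IsUniformCodebook C ∧ C.card ≤ N ∧
      ∫ y, C.inf' hC (fun c => (y - c) ^ 2) ∂(gaussianReal 0 v) ≤
        δ ^ 2 * (1 / 12 + (1 + 1 / v) * (δ + δ ^ 2)) + 2 * v * rexp (-L ^ 2 / (2 * v)) := by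
  have hN1 : (0 : ℝ) < N - 1 := by
    have : (2 : ℝ) ≤ N := by exact_mod_cast hN
    linarith
  have hδ0 : 0 < δ := by rw [hδ]; positivity
  have hNδ : (N - 1) * δ = 2 * L := by rw [hδ]; field_simp
  set C := Finset.image (fun i : ℕ => -L + i * δ) (Finset.range N) with hCdef
  have hmem : ∀ i < N, -L + i * δ ∈ C := fun i hi =>
    Finset.mem_image.2 ⟨i, Finset.mem_range.2 hi, rfl⟩
  have hC : C.Nonempty := ⟨_, hmem 0 (by lia)⟩
  refine ⟨C, hC, ⟨-L, δ, N, hδ0, rfl⟩, Finset.card_image_le.trans (by simp), ?_⟩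
  set E := rexp (-L ^ 2 / (2 * v)) with hE
  have i1 := (integrable_gaussianReal_iff hv).1 (integrable_inf'_sub_sq C hC v)
  have i2 := ((integrable_gaussianReal_iff hv).1
    (integrable_roundSq_comp (μ := gaussianReal 0 v) δ (-L))).const_mul (δ ^ 2)
  have i3 := ((integrable_gaussianReal_iff hv).1 (integrable_sub_sq_gaussianReal L L v)).const_mul E
  have i4 := ((integrable_gaussianReal_iff hv).1
    (integrable_sub_sq_gaussianReal (-L) (-L) v)).const_mul E
  have key := integral_mono i1 ((i2.add i3).add i4) fun y => by
    have hinf : ∀ i < N, (C.inf' hC fun c => (y - c) ^ 2) ≤ (y - (-L + i * δ)) ^ 2 := fun i hi =>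
      Finset.inf'_le (fun c => (y - c) ^ 2) (hmem i hi)
    have hp := gaussianPDFReal_nonneg 0 v y
    have n2 : 0 ≤ δ ^ 2 * (gaussianPDFReal 0 v y * roundSq ((y - -L) / δ)) :=
      mul_nonneg (sq_nonneg _) (mul_nonneg hp (roundSq_nonneg _))
    have n3 : 0 ≤ E * (gaussianPDFReal L v y * (y - L) ^ 2) :=
      mul_nonneg (Real.exp_pos _).le (mul_nonneg (gaussianPDFReal_nonneg _ _ _) (sq_nonneg _))
    have n4 : 0 ≤ E * (gaussianPDFReal (-L) v y * (y - -L) ^ 2) :=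
      mul_nonneg (Real.exp_pos _).le (mul_nonneg (gaussianPDFReal_nonneg _ _ _) (sq_nonneg _))
    simp only [Pi.add_apply]
    rcases lt_or_ge y (-L) with h | h
    · have h1 := hinf 0 (by lia)
      have h2 := gaussianPDFReal_le_exp_mul (v := v) (L := -L) (y := y) (by nlinarith)
      rw [neg_sq] at h2
      have h3 := mul_le_mul h2 h1 (Finset.le_inf' _ _ fun c _ => sq_nonneg _)
        (hp.trans h2)
      have : E * gaussianPDFReal (-L) v y * (y - (-L + (0 : ℕ) * δ)) ^ 2
          = E * (gaussianPDFReal (-L) v y * (y - -L) ^ 2) := by push_cast; ring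
      linarith
    rcases lt_or_ge L y with h' | h'
    · have h1 := hinf (N - 1) (by lia)
      rw [Nat.cast_sub (by lia), Nat.cast_one, hNδ] at h1
      have h2 := gaussianPDFReal_le_exp_mul (v := v) (L := L) (y := y) (by nlinarith)
      have h3 := mul_le_mul h2 h1 (Finset.le_inf' _ _ fun c _ => sq_nonneg _)
        (hp.trans h2)
      have : E * gaussianPDFReal L v y * (y - (-L + 2 * L)) ^ 2
          = E * (gaussianPDFReal L v y * (y - L) ^ 2) := by ring
      linarith
    · set t := (y - -L) / δ with ht
      have ht0 : 0 ≤ t := div_nonneg (by linarith) hδ0.le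
      have ht1 : t ≤ N - 1 := by rw [ht, div_le_iff₀ hδ0, hNδ]; linarith
      have hr0 : 0 ≤ round t := by rw [round_eq]; exact Int.floor_nonneg.2 (by linarith)
      have hr1 : round t < N := by
        rw [round_eq, Int.floor_lt]; push_cast; linarith
      obtain ⟨n, hn⟩ := Int.eq_ofNat_of_zero_le hr0
      have h1 := hinf n (by lia)
      have h2 : (y - (-L + n * δ)) ^ 2 = δ ^ 2 * roundSq t := by
        unfold roundSq
        rw [hn, ht]
        push_cast
        field_simp
        ring
      rw [h2] at h1
      have h3 := mul_le_mul_of_nonneg_left h1 hp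
      linarith
  have hg := (abs_le.1 (gaussRoundSq_sub_abs_le hv hδ0 (-L))).2
  have hg' := mul_le_mul_of_nonneg_left hg (sq_nonneg δ)
  have i23 := i2.add i3
  rw [integral_add' i23 i4, integral_add' i2 i3, integral_const_mul, integral_const_mul,
    integral_const_mul, ← integral_gaussianReal_eq hv, ← integral_gaussianReal_eq hv,
    ← integral_gaussianReal_eq hv, ← integral_gaussianReal_eq hv,
    integral_sub_mean_sq_gaussianReal, integral_sub_mean_sq_gaussianReal] at key
  change _ ≤ δ ^ 2 * gaussRoundSq v δ (-L) + _ + _ at key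
  linarith

lemma DuGauss_le {σ : ℝ} (hσ : 0 < σ) {R : ℕ} (hR : 1 ≤ R) {L δ : ℝ} (hL : 0 < L)
    (hδ : δ = 2 * L / (2 ^ R - 1)) :
    DuGauss σ R ≤ δ ^ 2 * (1 / 12 + (1 + 1 / σ ^ 2) * (δ + δ ^ 2))
      + 2 * σ ^ 2 * rexp (-L ^ 2 / (2 * σ ^ 2)) := by
  have hv : (σ ^ 2).toNNReal ≠ 0 := (Real.toNNReal_pos.2 (by positivity)).ne'
  obtain ⟨C, hC, hu, hcard, h⟩ := exists_integral_inf'_le (N := 2 ^ R)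
    (Nat.le_self_pow (by lia) 2) hv hL (by exact_mod_cast hδ)
  rw [Real.coe_toNNReal _ (sq_nonneg σ)] at h
  refine le_trans (csInf_le ⟨0, ?_⟩ ?_) h
  · rintro d ⟨C, hC, -, -, rfl⟩
    exact integral_nonneg fun y => Finset.le_inf' _ _ fun c _ => sq_nonneg _
  · exact ⟨C, hC, hu, hcard, rfl⟩

lemma le_DuGauss {σ : ℝ} (hσ : 0 < σ) (R : ℕ) {L δ : ℝ} (hL : 0 < L) (hδ : δ = 2 * L / 2 ^ R)
    (hB : 0 ≤ 1 / 12 - (1 + 1 / σ ^ 2) * (2 * δ + (2 * δ) ^ 2)) :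
    min (δ ^ 2 * (1 / 12 - (1 + 1 / σ ^ 2) * (2 * δ + (2 * δ) ^ 2)))
      (gaussianPDFReal 0 (σ ^ 2).toNNReal (L + 2)) ≤ DuGauss σ R := by
  have hv : (σ ^ 2).toNNReal ≠ 0 := (Real.toNNReal_pos.2 (by positivity)).ne'
  refine le_csInf ?_ ?_
  · exact ⟨_, {0}, by simp, ⟨0, 1, 1, one_pos, by simp⟩, by simpa using Nat.one_le_two_pow, rfl⟩
  · rintro d ⟨C, hC, hu, hcard, rfl⟩
    have h := min_le_integral_inf' C hC hu hcard hv hL (by exact_mod_cast hδ)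
    rw [Real.coe_toNNReal _ (sq_nonneg σ)] at h
    exact h hB

lemma tendsto_mul_exp_neg_sq : Tendsto (fun x : ℝ => x * rexp (-x ^ 2)) atTop (nhds 0) := by
  have h := (Real.tendsto_pow_mul_exp_neg_atTop_nhds_zero 1).comp
    (tendsto_pow_atTop (α := ℝ) (two_ne_zero))
  have h2 := h.mul tendsto_inv_atTop_zero
  rw [mul_zero] at h2
  refine h2.congr' ?_
  filter_upwards [eventually_gt_atTop 0] with x hx
  simp only [Function.comp_apply]
  field_simp

lemma tendsto_lower_main (σ K : ℝ) :
    Tendsto (fun x : ℝ => Real.log 2 * rexp (x ^ 2) ^ 2 / x ^ 2 *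
      ((2 * (2 * σ * (x - 1) - 2) / rexp (x ^ 2)) ^ 2 *
        (1 / 12 - K * (2 * (2 * (2 * σ * (x - 1) - 2) / rexp (x ^ 2)) +
          (2 * (2 * (2 * σ * (x - 1) - 2) / rexp (x ^ 2))) ^ 2)))) atTop
      (nhds (4 / 3 * σ ^ 2 * Real.log 2)) ∧
    Tendsto (fun x : ℝ => 1 / 12 - K * (2 * (2 * (2 * σ * (x - 1) - 2) / rexp (x ^ 2)) +
          (2 * (2 * (2 * σ * (x - 1) - 2) / rexp (x ^ 2))) ^ 2)) atTop (nhds (1 / 12)) := by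
  have hL : Tendsto (fun x : ℝ => 2 * σ - (2 * σ + 2) * x⁻¹) atTop (nhds (2 * σ)) := by
    simpa using (tendsto_const_nhds (x := 2 * σ)).sub (tendsto_inv_atTop_zero.const_mul (2 * σ + 2))
  have hδ : Tendsto (fun x : ℝ => 2 * (2 * σ * (x - 1) - 2) / rexp (x ^ 2)) atTop (nhds 0) := by
    have h := (hL.const_mul 2).mul tendsto_mul_exp_neg_sq
    rw [mul_zero] at h
    refine h.congr' ?_
    filter_upwards [eventually_gt_atTop 0] with x hx
    rw [Real.exp_neg]
    field_simp
    ring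
  have hB : Tendsto (fun x : ℝ => 1 / 12 - K * (2 * (2 * (2 * σ * (x - 1) - 2) / rexp (x ^ 2)) +
      (2 * (2 * (2 * σ * (x - 1) - 2) / rexp (x ^ 2))) ^ 2)) atTop (nhds (1 / 12)) := by
    have h := ((((hδ.const_mul 2).add ((hδ.const_mul 2).pow 2)).const_mul K).const_sub (1 / 12))
    simpa using h
  refine ⟨?_, hB⟩
  have h := ((hL.pow 2).const_mul (Real.log 2 * 4)).mul hB
  have e : Real.log 2 * 4 * (2 * σ) ^ 2 * (1 / 12) = 4 / 3 * σ ^ 2 * Real.log 2 := by ring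
  rw [e] at h
  refine h.congr' ?_
  filter_upwards [eventually_gt_atTop 0] with x hx
  have hE := Real.exp_pos (x ^ 2)
  rw [← mul_assoc]
  congr 1
  field_simp
  ring

lemma tendsto_tail_atTop {σ : ℝ} (hσ : 0 < σ) :
    Tendsto (fun x : ℝ => Real.log 2 * rexp (x ^ 2) ^ 2 / x ^ 2 *
      gaussianPDFReal 0 (σ ^ 2).toNNReal (2 * σ * (x - 1) - 2 + 2)) atTop atTop := by
  have hlog : 0 < Real.log 2 := Real.log_pos one_lt_two
  have hc : 0 < Real.log 2 * (√(2 * π * σ ^ 2))⁻¹ := by positivity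
  refine tendsto_atTop_mono' _ ?_ ((Real.tendsto_exp_div_pow_atTop 2).const_mul_atTop hc)
  filter_upwards [eventually_ge_atTop 1] with x hx
  unfold gaussianPDFReal
  rw [Real.coe_toNNReal _ (sq_nonneg σ)]
  have e : -(2 * σ * (x - 1) - 2 + 2 - 0) ^ 2 / (2 * σ ^ 2) = -(2 * (x - 1) ^ 2) := by
    field_simp
    ring
  rw [e]
  have h : rexp x ≤ rexp (x ^ 2) ^ 2 * rexp (-(2 * (x - 1) ^ 2)) := by
    rw [← Real.exp_nat_mul, ← Real.exp_add]
    gcongr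
    push_cast
    nlinarith
  calc Real.log 2 * (√(2 * π * σ ^ 2))⁻¹ * (rexp x / x ^ 2)
      ≤ Real.log 2 * (√(2 * π * σ ^ 2))⁻¹ *
        (rexp (x ^ 2) ^ 2 * rexp (-(2 * (x - 1) ^ 2)) / x ^ 2) := by gcongr
    _ = _ := by ring

lemma tendsto_upper {σ : ℝ} (hσ : 0 < σ) (K : ℝ) :
    Tendsto (fun x : ℝ => Real.log 2 * rexp (x ^ 2) ^ 2 / x ^ 2 *
      ((2 * (2 * σ * x) / (rexp (x ^ 2) - 1)) ^ 2 *
        (1 / 12 + K * (2 * (2 * σ * x) / (rexp (x ^ 2) - 1) +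
          (2 * (2 * σ * x) / (rexp (x ^ 2) - 1)) ^ 2)) +
        2 * σ ^ 2 * rexp (-(2 * σ * x) ^ 2 / (2 * σ ^ 2)))) atTop
      (nhds (4 / 3 * σ ^ 2 * Real.log 2)) := by
  have hq : Tendsto (fun x : ℝ => (1 - rexp (-x ^ 2))⁻¹) atTop (nhds 1) := by
    have h : Tendsto (fun x : ℝ => rexp (-x ^ 2)) atTop (nhds 0) :=
      Real.tendsto_exp_neg_atTop_nhds_zero.comp (tendsto_pow_atTop (α := ℝ) two_ne_zero)
    simpa using (h.const_sub 1).inv₀ (by norm_num)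
  have hE : ∀ x : ℝ, 0 < x → 0 < rexp (x ^ 2) - 1 := fun x hx => by
    have := Real.add_one_lt_exp (x := x ^ 2) (by positivity)
    nlinarith
  have heq : ∀ x : ℝ, 0 < x → (1 - rexp (-x ^ 2))⁻¹ = rexp (x ^ 2) / (rexp (x ^ 2) - 1) :=
    fun x hx => by
      have h1 := hE x hx
      have h2 := Real.exp_pos (x ^ 2)
      rw [Real.exp_neg, inv_eq_iff_eq_inv, inv_div]
      field_simp
  have hδ : Tendsto (fun x : ℝ => 2 * (2 * σ * x) / (rexp (x ^ 2) - 1)) atTop (nhds 0) := by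
    have h := (tendsto_mul_exp_neg_sq.mul hq).const_mul (4 * σ)
    rw [zero_mul, mul_zero] at h
    refine h.congr' ?_
    filter_upwards [eventually_gt_atTop 0] with x hx
    have h1 := (hE x hx).ne'
    rw [heq x hx, Real.exp_neg]
    field_simp
    ring
  have hB := ((hδ.add (hδ.pow 2)).const_mul K).const_add (1 / 12)
  have hx2 : Tendsto (fun x : ℝ => (x ^ 2)⁻¹) atTop (nhds 0) :=
    tendsto_inv_atTop_zero.comp (tendsto_pow_atTop two_ne_zero)
  have h := (((hq.pow 2).const_mul (Real.log 2 * 16 * σ ^ 2)).mul hB).add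
    (hx2.const_mul (Real.log 2 * (2 * σ ^ 2)))
  have e : Real.log 2 * 16 * σ ^ 2 * 1 ^ 2 * (1 / 12 + K * (0 + 0 ^ 2))
      + Real.log 2 * (2 * σ ^ 2) * 0 = 4 / 3 * σ ^ 2 * Real.log 2 := by ring
  rw [e] at h
  refine h.congr' ?_
  filter_upwards [eventually_gt_atTop 0] with x hx
  have h1 := (hE x hx).ne'
  have e2 : -(2 * σ * x) ^ 2 / (2 * σ ^ 2) = -(x ^ 2 + x ^ 2) := by
    field_simp
    ring
  have e3 : rexp (x ^ 2) ^ 2 * rexp (-(x ^ 2 + x ^ 2)) = 1 := by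
    rw [sq, ← Real.exp_add, ← Real.exp_add, add_neg_cancel, Real.exp_zero]
  rw [heq x hx, mul_add (_ / _), ← mul_assoc (_ / _) (_ ^ 2) (_ + _), e2]
  congr 1
  · congr 1
    field_simp
    ring
  · rw [show Real.log 2 * rexp (x ^ 2) ^ 2 / x ^ 2 * (2 * σ ^ 2 * rexp (-(x ^ 2 + x ^ 2)))
      = Real.log 2 * (2 * σ ^ 2) * (x ^ 2)⁻¹ * (rexp (x ^ 2) ^ 2 * rexp (-(x ^ 2 + x ^ 2))) by ring,
      e3, mul_one]

/-- Optimal uniform scalar quantization of a Gaussian source (equation (18)):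
`lim_{R→∞} (2^{2R}/R) D_u*(R) = (4/3) σ² ln 2`. -/
theorem stmt8 (σ : ℝ) (hσ : 0 < σ) :
    Filter.Tendsto (fun R : ℕ => (2 : ℝ) ^ (2 * R) / (R : ℝ) * DuGauss σ R)
      Filter.atTop (nhds (4 / 3 * σ ^ 2 * Real.log 2)) := by
  have hlog : 0 < Real.log 2 := Real.log_pos one_lt_two
  set X : ℕ → ℝ := fun R => √(R * Real.log 2) with hX
  have hXtop : Tendsto X atTop atTop :=
    tendsto_sqrt_atTop.comp (tendsto_natCast_atTop_atTop.atTop_mul_const hlog)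
  have hXsq : ∀ R, X R ^ 2 = R * Real.log 2 := fun R => Real.sq_sqrt (by positivity)
  have hXexp : ∀ R, rexp (X R ^ 2) = 2 ^ R := fun R => by
    rw [hXsq, Real.exp_nat_mul, Real.exp_log two_pos]
  have hfac : ∀ R : ℕ, (2 : ℝ) ^ (2 * R) / R = Real.log 2 * rexp (X R ^ 2) ^ 2 / X R ^ 2 :=
    fun R => by
      rw [hXexp, hXsq, mul_comm (R : ℝ), mul_div_mul_left _ _ hlog.ne', ← pow_mul, mul_comm R]
  obtain ⟨hlow, hB⟩ := tendsto_lower_main σ (1 + 1 / σ ^ 2)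
  have htail := tendsto_tail_atTop hσ
  refine tendsto_of_tendsto_of_tendsto_of_le_of_le' (hlow.comp hXtop)
    ((tendsto_upper hσ (1 + 1 / σ ^ 2)).comp hXtop) ?_ ?_
  · have hle := hlow.eventually (gt_mem_nhds (lt_add_one _))
    have hev := hle.and ((htail.eventually_ge_atTop (4 / 3 * σ ^ 2 * Real.log 2 + 1)).and
      ((hB.eventually (lt_mem_nhds (show (0 : ℝ) < 1 / 12 by norm_num))).and
        (eventually_gt_atTop (1 + 1 / σ))))
    filter_upwards [hXtop.eventually hev] with R hR
    obtain ⟨h1, h2, h3, h4⟩ := hR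
    have hL : 0 < 2 * σ * (X R - 1) - 2 := by
      have h5 : 1 / σ < X R - 1 := by linarith
      rw [div_lt_iff₀ hσ] at h5
      linarith
    have h := le_DuGauss hσ R hL (congrArg _ (hXexp R)) h3.le
    have hnn : 0 ≤ Real.log 2 * rexp (X R ^ 2) ^ 2 / X R ^ 2 := by positivity
    rw [hfac]
    have h5 := mul_le_mul_of_nonneg_left h hnn
    rw [mul_min_of_nonneg _ _ hnn, min_eq_left (h1.le.trans h2)] at h5
    exact h5
  · filter_upwards [eventually_ge_atTop 1, hXtop.eventually (eventually_gt_atTop 0)] with R hR hx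
    have h := DuGauss_le hσ hR (L := 2 * σ * X R) (by positivity)
      (congrArg (fun z => 2 * (2 * σ * X R) / (z - 1)) (hXexp R))
    rw [hfac]
    exact mul_le_mul_of_nonneg_left h (by positivity)
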